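/- If f ∈ Mould(m) and g ∈ Mould(n) are vegetal, then f / Y and Y \ f are vegetal, and ARIT(f,g) and ARI(f,g) are vegetal elements of Mould(m+n). -/

import Mathlib

/-!
Formalization of results from "The anticyclic operad of moulds" (F. Chapoton).

`Mould n` is the field of rational functions in variables `u 1, …, u n` with
rational coefficients, realized as a subfield of the fraction field `K` of
`ℚ[X 0, X 1, X 2, …]`.  The variable `u 0 = X 0` is reserved as an auxiliary
variable (the parameter `t` or `λ`).  Substitution of rational functions for
the variables is realized by the (partial, well-defined) function `msub`.
-/

noncomputable section
namespace MouldOperad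

open MvPolynomial Finset

attribute [local instance] Classical.propDecidable
set_option synthInstance.maxHeartbeats 1000000

abbrev MPoly : Type := MvPolynomial ℕ ℚ
abbrev K : Type := FractionRing MPoly

/-- the variable `u i` (1-based; index `0` is auxiliary). -/
def u (i : ℕ) : K := algebraMap MPoly K (X i)

/-- `u_{i..j} = u_i + u_{i+1} + ⋯ + u_j`. -/
def usum (i j : ℕ) : K := ∑ k ∈ Finset.Icc i j, u k

/-- evaluation of polynomials, sending the variable `X k` to `v k`. -/
def pev (v : ℕ → K) : MPoly →+* K :=
  eval₂Hom ((algebraMap MPoly K).comp (C : ℚ →+* MPoly)) v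

/-- Substitution of the rational functions `v k` for the variables of `f ∈ K`
(the induced field homomorphism): it takes the canonical value whenever `f` has
a fraction representation whose denominator does not vanish under the
substitution (this value does not depend on the representation), and the junk
value `0` otherwise. -/
def msub (v : ℕ → K) (f : K) : K :=
  if h : ∃ w : K, ∃ p q : MPoly, q ≠ 0 ∧
      f = algebraMap MPoly K p / algebraMap MPoly K q ∧
      pev v q ≠ 0 ∧ w = pev v p / pev v q
  then h.choose else 0

/-- the field `Mould n` of rational functions in `u 1, …, u n`. -/
def Mould (n : ℕ) : Subfield K :=
  Subfield.closure {x : K | ∃ i, 1 ≤ i ∧ i ≤ n ∧ x = u i}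

/-- substitution used for `f` in `f ∘_i g`, where `g` has degree `n`:
`f(u_1, …, u_{i-1}, u_{i..i+n-1}, u_{i+n}, …, u_{m+n-1})`. -/
def compSubF (n i : ℕ) : ℕ → K := fun k =>
  if k < i then u k else if k = i then usum i (i + n - 1) else u (k + n - 1)

/-- substitution used for `g` in `f ∘_i g` : `g(u_i, …, u_{i+n-1})`. -/
def compSubG (i : ℕ) : ℕ → K := fun k => u (k + i - 1)

/-- the composition `f ∘_i g`, where `g` has degree `n` (1-based index `i`). -/
def comp (n i : ℕ) (f g : K) : K :=
  usum i (i + n - 1) * msub (compSubF n i) f * msub (compSubG i) g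

/-- the push `τ` on `Mould n`: `τ(f)(u_1,…,u_n) = f(-u_{1..n}, u_1, …, u_{n-1})`. -/
def push (n : ℕ) (f : K) : K :=
  msub (fun k => if k = 1 then -(usum 1 n) else if k ≤ n then u (k - 1) else u k) f

/-- a permutation of `Fin n` as a (1-based) permutation of `ℕ`. -/
def permExt (n : ℕ) (σ : Equiv.Perm (Fin n)) : ℕ → ℕ := fun k =>
  if h : 1 ≤ k ∧ k ≤ n then ((σ ⟨k - 1, by omega⟩ : Fin n) : ℕ) + 1 else k

/-- `f ∈ Mould n` is alternal : for each `1 ≤ i ≤ n-1`, the sum of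
`f(u_{σ(1)}, …, u_{σ(n)})` over the shuffles `σ ∈ Sh(i, n-i)` vanishes. -/
def IsAlternal (n : ℕ) (f : K) : Prop :=
  ∀ i : ℕ, 1 ≤ i → i ≤ n - 1 →
    ∑ σ ∈ Finset.univ.filter (fun σ : Equiv.Perm (Fin n) =>
        (∀ a b : Fin n, a < b → (b : ℕ) < i → σ a < σ b) ∧
        (∀ a b : Fin n, a < b → i ≤ (a : ℕ) → σ a < σ b)),
      msub (fun k => u (permExt n σ k)) f = 0

/-- `f ∈ Mould n` is vegetal :
`u_1⋯u_n · Σ_{σ ∈ S_n} f(t·u_{σ(1)}, …, t·u_{σ(n)}) = n! · f(t,…,t)`,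
where the auxiliary variable `t` is `u 0`. -/
def IsVegetal (n : ℕ) (f : K) : Prop :=
  (∏ k ∈ Finset.Icc 1 n, u k) *
      ∑ σ : Equiv.Perm (Fin n), msub (fun k => u 0 * u (permExt n σ k)) f =
    (n.factorial : K) * msub (fun _ => u 0) f

/-- `f ∈ Mould n` is homogeneous of weight `d` : `f(λu_1,…,λu_n) = λ^d·f`,
where the auxiliary variable `λ` is `u 0`. -/
def IsHomogeneousOfWeight (n : ℕ) (d : ℤ) (f : K) : Prop :=
  msub (fun k => if 1 ≤ k ∧ k ≤ n then u 0 * u k else u k) f = u 0 ^ d * f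

/-- shift substitution : `g(u_{m+1}, …, u_{m+n})`. -/
def shiftSub (m : ℕ) : ℕ → K := fun k => u (k + m)

/-- `f ≻ g` for `f ∈ Mould m`, `g ∈ Mould n`. -/
def dsucc (m n : ℕ) (f g : K) : K :=
  f * msub (shiftSub m) g * usum (m + 1) (m + n) / usum 1 (m + n)

/-- `f ≺ g` for `f ∈ Mould m`, `g ∈ Mould n`. -/
def dprec (m n : ℕ) (f g : K) : K :=
  f * msub (shiftSub m) g * usum 1 m / usum 1 (m + n)

/-- `MU(f,g)` for `f ∈ Mould m`. -/
def MU (m : ℕ) (f g : K) : K := f * msub (shiftSub m) g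

/-- `LIMU(f,g) = MU(f,g) - MU(g,f)` for `f ∈ Mould m`, `g ∈ Mould n`. -/
def LIMU (m n : ℕ) (f g : K) : K := MU m f g - MU n g f

/-- the pre-Lie product `f ↶ g` for `f ∈ Mould m`, `g ∈ Mould n`. -/
def preLieCurve (m n : ℕ) (f g : K) : K :=
  f * msub (shiftSub m) g * usum (m + 1) (m + n) / usum 1 (m + n)
    - g * msub (shiftSub n) f * usum 1 n / usum 1 (m + n)

/-- the pre-Lie product `f ∘ g = Σ_{i=1}^m f ∘_i g`, `f ∈ Mould m`, `g ∈ Mould n`. -/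
def preLieComp (m n : ℕ) (f g : K) : K := ∑ i ∈ Finset.Icc 1 m, comp n i f g

/-- `H_n = ∏_{1 ≤ i ≤ j ≤ n} u_{i..j}`. -/
def Hprod (n : ℕ) : K := ∏ i ∈ Finset.Icc 1 n, ∏ j ∈ Finset.Icc i n, usum i j

/-- `x` is (the image of) a polynomial in `u_1, …, u_n`. -/
def IsPolyIn (n : ℕ) (x : K) : Prop :=
  ∃ p : MPoly, (∀ k ∈ p.vars, 1 ≤ k ∧ k ≤ n) ∧ x = algebraMap MPoly K p

/-- `f ∈ Mould n` has nice poles: it is a polynomial divided by a product of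
powers of the linear forms `u_{i..j}`, `1 ≤ i ≤ j ≤ n`. -/
def HasNicePoles (n : ℕ) (f : K) : Prop :=
  ∃ (P : MPoly) (e : ℕ → ℕ → ℕ),
    (∀ k ∈ P.vars, 1 ≤ k ∧ k ≤ n) ∧
    f = algebraMap MPoly K P /
        ∏ i ∈ Finset.Icc 1 n, ∏ j ∈ Finset.Icc i n, usum i j ^ e i j

/-- the Over product `f / Y`, `f ∈ Mould n`. -/
def overY (n : ℕ) (f : K) : K := f / usum 1 (n + 1)

/-- the Under product `Y \ f`, `f ∈ Mould n`. -/
def underY (n : ℕ) (f : K) : K := msub (fun k => u (k + 1)) f / usum 1 (n + 1)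

/-- `ARIT(f,g) = f ∘ (g/Y) - f ∘ (Y\g)` for `f ∈ Mould m`, `g ∈ Mould n`. -/
def ARIT (m n : ℕ) (f g : K) : K :=
  preLieComp m (n + 1) f (overY n g) - preLieComp m (n + 1) f (underY n g)

/-- `ARI(f,g) = ARIT(f,g) - ARIT(g,f) + LIMU(f,g)`, `f ∈ Mould m`, `g ∈ Mould n`. -/
def ARI (m n : ℕ) (f g : K) : K := ARIT m n f g - ARIT n m g f + LIMU m n f g

/-- evaluation of polynomials into `RatFunc K` (rational functions in `t` over `K`). -/
def pevR (v : ℕ → RatFunc K) : MPoly →+* RatFunc K :=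
  eval₂Hom ((RatFunc.C).comp ((algebraMap MPoly K).comp (C : ℚ →+* MPoly))) v

/-- substitution into `RatFunc K`. -/
def msubR (v : ℕ → RatFunc K) (f : K) : RatFunc K :=
  if h : ∃ w : RatFunc K, ∃ p q : MPoly, q ≠ 0 ∧
      f = algebraMap MPoly K p / algebraMap MPoly K q ∧
      pevR v q ≠ 0 ∧ w = pevR v p / pevR v q
  then h.choose else 0

/-- residue at `t = 0`: the coefficient of `t⁻¹` in the Laurent expansion at `0`. -/
def res (r : RatFunc K) : K := (↑r : LaurentSeries K).coeff (-1)

/-- the mould derivative `∂f` for `f ∈ Mould m`: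
`∂f(u_1,…,u_{m-1}) = Σ_{j=1}^m Res_{t=0} f(u_1,…,u_{j-1},t,u_j,…,u_{m-1})`,
where `f(u_1,…,u_{j-1},t,u_j,…,u_{m-1})` is viewed in `RatFunc K`. -/
def mderiv (m : ℕ) (f : K) : K :=
  ∑ j ∈ Finset.Icc 1 m,
    res (msubR (fun k =>
      if k < j then RatFunc.C (u k)
      else if k = j then RatFunc.X
      else RatFunc.C (u (k - 1))) f)

/-- evaluation of polynomials into `ℚ(x)`, sending every variable to `1/x`. -/
def pevX : MPoly →+* RatFunc ℚ :=
  eval₂Hom (RatFunc.C : ℚ →+* RatFunc ℚ) (fun _ => (RatFunc.X)⁻¹)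

/-- the substitution `u_i ↦ 1/x`, landing in `ℚ(x)`. -/
def evalx (f : K) : RatFunc ℚ :=
  if h : ∃ w : RatFunc ℚ, ∃ p q : MPoly, q ≠ 0 ∧
      f = algebraMap MPoly K p / algebraMap MPoly K q ∧
      pevX q ≠ 0 ∧ w = pevX p / pevX q
  then h.choose else 0

/-- the derivative `d/dx` on `ℚ(x)`. -/
def rfDeriv (r : RatFunc ℚ) : RatFunc ℚ :=
  (algebraMap (Polynomial ℚ) (RatFunc ℚ) (Polynomial.derivative r.num) *
      algebraMap (Polynomial ℚ) (RatFunc ℚ) r.denom -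
    algebraMap (Polynomial ℚ) (RatFunc ℚ) r.num *
      algebraMap (Polynomial ℚ) (RatFunc ℚ) (Polynomial.derivative r.denom)) /
    algebraMap (Polynomial ℚ) (RatFunc ℚ) r.denom ^ 2

lemma algebraMap_injective : Function.Injective (algebraMap MPoly K) :=
  IsFractionRing.injective MPoly K

lemma u_ne_zero (i : ℕ) : u i ≠ 0 := by
  rw [u, Ne, FaithfulSMul.algebraMap_eq_zero_iff]
  exact X_ne_zero i

@[simp] lemma pev_X (v : ℕ → K) (k : ℕ) : pev v (X k) = v k := by
  simp [pev]

lemma pev_unique (φ : MPoly →+* K) (v : ℕ → K) (h : ∀ k, φ (X k) = v k) : φ = pev v := by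
  refine ringHom_ext (fun r => ?_) (fun k => by simp [h])
  exact congrArg (fun ψ : ℚ →+* K => ψ r) (Subsingleton.elim (φ.comp C) ((pev v).comp C))

lemma map_pev (φ : K →+* K) (v : ℕ → K) (p : MPoly) : φ (pev v p) = pev (fun k => φ (v k)) p :=
  DFunLike.congr_fun (pev_unique (φ.comp (pev v)) _ (by simp)) p

lemma pev_comp_algHom (w : MPoly →ₐ[ℚ] MPoly) (v : ℕ → K) (p : MPoly) :
    pev v (w p) = pev (fun k => pev v (w (X k))) p :=
  DFunLike.congr_fun (pev_unique ((pev v).comp (w : MPoly →+* MPoly)) _ (by simp)) p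

lemma pev_u (p : MPoly) : pev u p = algebraMap MPoly K p :=
  (DFunLike.congr_fun (pev_unique (algebraMap MPoly K) u fun _ => rfl) p).symm

/-- `f` has a fraction representation that is defined at `v`, with value `w`. -/
def IsVal (v : ℕ → K) (f w : K) : Prop :=
  ∃ p q : MPoly, q ≠ 0 ∧ f = algebraMap MPoly K p / algebraMap MPoly K q ∧
    pev v q ≠ 0 ∧ w = pev v p / pev v q

lemma IsVal.unique {v : ℕ → K} {f w w' : K} (h : IsVal v f w) (h' : IsVal v f w') : w = w' := by
  obtain ⟨p, q, hq, rfl, hv, rfl⟩ := h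
  obtain ⟨p', q', hq', he, hv', rfl⟩ := h'
  have hq := (FaithfulSMul.algebraMap_eq_zero_iff MPoly K).not.mpr hq
  have hq' := (FaithfulSMul.algebraMap_eq_zero_iff MPoly K).not.mpr hq'
  rw [div_eq_div_iff hq hq', ← map_mul, ← map_mul] at he
  rw [div_eq_div_iff hv hv', ← map_mul, ← map_mul, algebraMap_injective he]

lemma IsVal.msub_eq {v : ℕ → K} {f w : K} (h : IsVal v f w) : msub v f = w := by
  have h' : ∃ w, IsVal v f w := ⟨w, h⟩
  have e : msub v f = h'.choose := dif_pos h'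
  rw [e]
  exact h'.choose_spec.unique h

lemma msub_of_not {v : ℕ → K} {f : K} (h : ¬ ∃ w, IsVal v f w) : msub v f = 0 := dif_neg h

lemma isVal_algebraMap (v : ℕ → K) (p : MPoly) : IsVal v (algebraMap MPoly K p) (pev v p) :=
  ⟨p, 1, one_ne_zero, by simp, by simp, by simp⟩

lemma IsVal.add {v : ℕ → K} {f g a b : K} (hf : IsVal v f a) (hg : IsVal v g b) :
    IsVal v (f + g) (a + b) := by
  obtain ⟨p, q, hq, rfl, hv, rfl⟩ := hf
  obtain ⟨p', q', hq', rfl, hv', rfl⟩ := hg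
  refine ⟨p * q' + q * p', q * q', mul_ne_zero hq hq', ?_, by simp [hv, hv'], ?_⟩
  · have hq := (FaithfulSMul.algebraMap_eq_zero_iff MPoly K).not.mpr hq
    have hq' := (FaithfulSMul.algebraMap_eq_zero_iff MPoly K).not.mpr hq'
    rw [div_add_div _ _ hq hq']
    simp only [map_add, map_mul]
  · rw [div_add_div _ _ hv hv']
    simp only [map_add, map_mul]

lemma IsVal.mul {v : ℕ → K} {f g a b : K} (hf : IsVal v f a) (hg : IsVal v g b) :
    IsVal v (f * g) (a * b) := by
  obtain ⟨p, q, hq, rfl, hv, rfl⟩ := hf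
  obtain ⟨p', q', hq', rfl, hv', rfl⟩ := hg
  refine ⟨p * p', q * q', mul_ne_zero hq hq', ?_, by simp [hv, hv'], ?_⟩
  · simp only [map_mul, div_mul_div_comm]
  · simp only [map_mul, div_mul_div_comm]

lemma IsVal.inv {v : ℕ → K} {f a : K} (hf : IsVal v f a) (ha : a ≠ 0) : IsVal v f⁻¹ a⁻¹ := by
  obtain ⟨p, q, hq, rfl, hv, rfl⟩ := hf
  have hp : pev v p ≠ 0 := fun h => ha (by simp [h])
  exact ⟨q, p, fun h => hp (by simp [h]), inv_div _ _, hp, inv_div _ _⟩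

lemma IsVal.sum {ι : Type*} {v : ℕ → K} {f a : ι → K} (s : Finset ι)
    (h : ∀ i ∈ s, IsVal v (f i) (a i)) : IsVal v (∑ i ∈ s, f i) (∑ i ∈ s, a i) := by
  classical
  induction s using Finset.induction_on with
  | empty => simpa using isVal_algebraMap v 0
  | insert i s hi ih =>
    rw [Finset.sum_insert hi, Finset.sum_insert hi]
    exact (h i (Finset.mem_insert_self i s)).add
      (ih fun j hj => h j (Finset.mem_insert_of_mem hj))

lemma isVal_u (v : ℕ → K) (k : ℕ) : IsVal v (u k) (v k) :=
  pev_X v k ▸ isVal_algebraMap v (X k)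

lemma isVal_map_iff (φ : K →+* K) (v : ℕ → K) (f : K) :
    (∃ w, IsVal (fun k => φ (v k)) f w) ↔ ∃ w, IsVal v f w := by
  constructor <;> rintro ⟨w, p, q, hq, hf, hv, -⟩ <;> refine ⟨_, p, q, hq, hf, ?_, rfl⟩
  · rwa [← map_pev, map_ne_zero] at hv
  · rwa [← map_pev, map_ne_zero]

lemma map_msub (φ : K →+* K) (v : ℕ → K) (f : K) :
    φ (msub v f) = msub (fun k => φ (v k)) f := by
  by_cases h : ∃ w, IsVal v f w
  · obtain ⟨w, p, q, hq, rfl, hv, rfl⟩ := h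
    rw [IsVal.msub_eq ⟨p, q, hq, rfl, hv, rfl⟩, map_div₀, map_pev, map_pev]
    refine (IsVal.msub_eq ⟨p, q, hq, rfl, ?_, rfl⟩).symm
    rwa [← map_pev, map_ne_zero]
  · rw [msub_of_not h, msub_of_not ((isVal_map_iff φ v f).not.mpr h), map_zero]

/-- The field endomorphism `u k ↦ v k`, for algebraically independent `v`. -/
@[irreducible] def substHom (v : ℕ → K) (hv : Function.Injective (pev v)) : K →+* K :=
  IsFractionRing.lift hv

lemma substHom_algebraMap {v : ℕ → K} (hv : Function.Injective (pev v)) (p : MPoly) :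
    substHom v hv (algebraMap MPoly K p) = pev v p := by
  rw [substHom]
  exact IsFractionRing.lift_algebraMap hv p

lemma substHom_u {v : ℕ → K} (hv : Function.Injective (pev v)) (k : ℕ) :
    substHom v hv (u k) = v k := by
  rw [u, substHom_algebraMap, pev_X]

lemma msub_of_hom (φ : K →+* K) {v : ℕ → K} (h : ∀ k, φ (u k) = v k) (f : K) :
    msub v f = φ f := by
  obtain rfl : (fun k => φ (u k)) = v := funext h
  rw [← map_msub]
  obtain ⟨p, q, hq, rfl⟩ := IsFractionRing.div_surjective (A := MPoly) f
  have hq := nonZeroDivisors.ne_zero hq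
  refine congrArg φ (IsVal.msub_eq ⟨p, q, hq, rfl, ?_, by rw [pev_u, pev_u]⟩)
  rwa [pev_u, Ne, FaithfulSMul.algebraMap_eq_zero_iff]

lemma pev_rename_injective {r : ℕ → ℕ} (hr : Function.Injective r) :
    Function.Injective (pev fun k => u (r k)) := by
  intro p q h
  have e (p : MPoly) : pev (fun k => u (r k)) p = algebraMap MPoly K (rename r p) := by
    rw [← pev_u, pev_comp_algHom]
    simp
  rw [e, e] at h
  exact rename_injective r hr (algebraMap_injective h)

/-- The field endomorphism `u k ↦ u (r k)`. -/
@[irreducible] def renameHom (r : ℕ → ℕ) (hr : Function.Injective r) : K →+* K :=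
  substHom (fun k => u (r k)) (pev_rename_injective hr)

@[simp] lemma renameHom_u {r : ℕ → ℕ} (hr : Function.Injective r) (k : ℕ) :
    renameHom r hr (u k) = u (r k) := by
  rw [renameHom, substHom_u]

lemma msub_rename {r : ℕ → ℕ} (hr : Function.Injective r) (f : K) :
    msub (fun k => u (r k)) f = renameHom r hr f :=
  msub_of_hom _ (renameHom_u hr) f

lemma sq_div_mul_sq_div {F : Type*} [Field F] {a : F} (ha : a ≠ 0) (b : F) :
    a ^ 2 / a * (b ^ 2 / a) = b ^ 2 := by
  field_simp

lemma pev_dilate_injective : Function.Injective (pev fun k => u 0 * u k) := by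
  intro p q h
  let w : MPoly →ₐ[ℚ] MPoly := aeval fun k => X 0 * X k
  have e (p : MPoly) : pev (fun k => u 0 * u k) p = algebraMap MPoly K (w p) := by
    rw [← pev_u, pev_comp_algHom]
    simp [w]
  have esq (p : MPoly) : pev (fun k => u k ^ 2 / u 0) (w p) = algebraMap MPoly K (expand 2 p) := by
    have h (k : ℕ) : pev (fun k => u k ^ 2 / u 0) (w (X k)) = pev u (expand 2 (X k)) := by
      rw [expand_X, map_pow, pev_X, aeval_X, map_mul, pev_X, pev_X]
      exact sq_div_mul_sq_div (u_ne_zero 0) _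
    rw [← pev_u, pev_comp_algHom, pev_comp_algHom, funext h]
  rw [e, e] at h
  have hw : w p = w q := algebraMap_injective h
  exact expand_injective two_pos (algebraMap_injective (by rw [← esq, ← esq, hw]))

/-- The field endomorphism `u k ↦ u 0 * u k`. -/
@[irreducible] def dilateHom : K →+* K := substHom (fun k => u 0 * u k) pev_dilate_injective

@[simp] lemma dilateHom_u (k : ℕ) : dilateHom (u k) = u 0 * u k := by
  rw [dilateHom, substHom_u]

lemma hom_ext {φ ψ : K →+* K} (h : ∀ k, φ (u k) = ψ (u k)) (f : K) : φ f = ψ f := by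
  rw [← msub_of_hom φ h, msub_of_hom ψ fun _ => rfl]

lemma hom_eqOn_mould {φ ψ : K →+* K} {n : ℕ} (h : ∀ k, 1 ≤ k → k ≤ n → φ (u k) = ψ (u k))
    {f : K} (hf : f ∈ Mould n) : φ f = ψ f := by
  refine RingHom.eqOn_field_closure (s := {x : K | ∃ i, 1 ≤ i ∧ i ≤ n ∧ x = u i}) ?_ hf
  rintro _ ⟨i, h1, h2, rfl⟩
  exact h i h1 h2

lemma permExt_injective (n : ℕ) (σ : Equiv.Perm (Fin n)) : Function.Injective (permExt n σ) := by
  intro a b h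
  unfold permExt at h
  split_ifs at h with ha hb hb
  · have := σ.injective (Fin.ext (Nat.succ_injective h))
    simp only [Fin.mk.injEq] at this
    omega
  · have := (σ ⟨a - 1, by omega⟩).isLt
    omega
  · have := (σ ⟨b - 1, by omega⟩).isLt
    omega
  · exact h

lemma permExt_mem (n : ℕ) (σ : Equiv.Perm (Fin n)) {k : ℕ} (hk : k ∈ Finset.Icc 1 n) :
    permExt n σ k ∈ Finset.Icc 1 n := by
  have hk' := Finset.mem_Icc.mp hk
  have := (σ ⟨k - 1, by omega⟩).isLt
  simp only [permExt, hk', and_self, dite_true, Finset.mem_Icc]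
  omega

lemma permExt_mul (n : ℕ) (σ τ : Equiv.Perm (Fin n)) (k : ℕ) :
    permExt n (σ * τ) k = permExt n σ (permExt n τ k) := by
  by_cases h : 1 ≤ k ∧ k ≤ n
  · have hlt := (τ ⟨k - 1, by omega⟩).isLt
    simp [permExt, h, hlt]
  · simp [permExt, h]

lemma exists_permExt_eq (n : ℕ) (r : ℕ → ℕ) (hr : Function.Injective r)
    (h1 : ∀ k, 1 ≤ k → k ≤ n → 1 ≤ r k ∧ r k ≤ n) (h2 : ∀ k, ¬ (1 ≤ k ∧ k ≤ n) → r k = k) :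
    ∃ τ : Equiv.Perm (Fin n), permExt n τ = r := by
  let t : Fin n → Fin n := fun x =>
    ⟨r (x + 1) - 1, by have := h1 (x + 1) (by omega) (by omega); omega⟩
  have ht : Function.Injective t := by
    intro x y hxy
    have hx := h1 (x + 1) (by omega) (by omega)
    have hy := h1 (y + 1) (by omega) (by omega)
    have e : r (x + 1) - 1 = r (y + 1) - 1 := congrArg Fin.val hxy
    have := @hr (x + 1) (y + 1) (by omega)
    exact Fin.ext (by omega)
  refine ⟨Equiv.ofBijective t (Finite.injective_iff_bijective.mp ht), funext fun k => ?_⟩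
  by_cases h : 1 ≤ k ∧ k ≤ n
  · have := h1 k h.1 h.2
    simp only [permExt, h, and_self, dite_true, Equiv.ofBijective_apply, t]
    rw [Nat.sub_add_cancel h.1]
    omega
  · simp only [permExt, h, dite_false, h2 k h]

/-- The action of a permutation of the variables `u 1, …, u n`. -/
@[irreducible] def permHom (n : ℕ) (σ : Equiv.Perm (Fin n)) : K →+* K :=
  renameHom (permExt n σ) (permExt_injective n σ)

@[simp] lemma permHom_u (n : ℕ) (σ : Equiv.Perm (Fin n)) (k : ℕ) :
    permHom n σ (u k) = u (permExt n σ k) := by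
  rw [permHom, renameHom_u]

lemma permHom_mul (n : ℕ) (σ τ : Equiv.Perm (Fin n)) (f : K) :
    permHom n (σ * τ) f = permHom n σ (permHom n τ f) :=
  hom_ext (φ := permHom n (σ * τ)) (ψ := (permHom n σ).comp (permHom n τ))
    (by simp [permExt_mul]) f

/-- `Σ_{σ ∈ S_n} f(t·u_{σ(1)}, …, t·u_{σ(n)})`. -/
def symSum (n : ℕ) (f : K) : K := ∑ σ : Equiv.Perm (Fin n), dilateHom (permHom n σ f)

lemma sum_msub_eq_symSum (n : ℕ) (f : K) :
    ∑ σ : Equiv.Perm (Fin n), msub (fun k => u 0 * u (permExt n σ k)) f = symSum n f :=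
  Finset.sum_congr rfl fun σ _ => msub_of_hom (dilateHom.comp (permHom n σ)) (by simp) f

lemma symSum_add (n : ℕ) (f g : K) : symSum n (f + g) = symSum n f + symSum n g := by
  simp [symSum, Finset.sum_add_distrib]

lemma symSum_sub (n : ℕ) (f g : K) : symSum n (f - g) = symSum n f - symSum n g := by
  simp [symSum, Finset.sum_sub_distrib]

lemma symSum_sum {ι : Type*} (n : ℕ) (s : Finset ι) (f : ι → K) :
    symSum n (∑ i ∈ s, f i) = ∑ i ∈ s, symSum n (f i) := by
  simp only [symSum, map_sum]
  exact Finset.sum_comm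

lemma symSum_permHom (n : ℕ) (τ : Equiv.Perm (Fin n)) (f : K) :
    symSum n (permHom n τ f) = symSum n f := by
  simp only [symSum, ← permHom_mul]
  exact Fintype.sum_equiv (Equiv.mulRight τ) _ _ fun _ => rfl

lemma isVal_diag_symSum (n : ℕ) {f w : K} (h : IsVal (fun _ => u 0) f w) :
    IsVal (fun _ => u 0) (symSum n f) (n.factorial * dilateHom w) := by
  have : (n.factorial * dilateHom w : K) = ∑ _σ : Equiv.Perm (Fin n), dilateHom w := by
    simp [Fintype.card_perm]
  rw [this]
  refine IsVal.sum _ fun σ _ => ?_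
  obtain ⟨p, q, hq, rfl, hv, rfl⟩ := h
  let s : MPoly →ₐ[ℚ] MPoly := aeval fun k => X 0 * X (permExt n σ k)
  have e1 (p : MPoly) : dilateHom (permHom n σ (algebraMap MPoly K p)) =
      algebraMap MPoly K (s p) := by
    rw [← pev_u, ← pev_u, pev_comp_algHom, map_pev, map_pev]
    simp [s]
  have e2 (p : MPoly) : pev (fun _ => u 0) (s p) = dilateHom (pev (fun _ => u 0) p) := by
    rw [pev_comp_algHom, map_pev]
    simp [s]
  have hs : pev (fun _ => u 0) (s q) ≠ 0 := by rwa [e2, map_ne_zero]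
  refine ⟨s p, s q, fun h => hs (by simp [h]), ?_, hs, ?_⟩
  · simp only [map_div₀, e1]
  · simp only [map_div₀, e2]

/-- A mould whose symmetrization vanishes is vegetal. -/
lemma isVegetal_of_symSum_eq_zero (n : ℕ) {f : K} (h : symSum n f = 0) : IsVegetal n f := by
  rw [IsVegetal, sum_msub_eq_symSum, h, mul_zero]
  by_cases hw : ∃ w, IsVal (fun _ => u 0) f w
  · obtain ⟨w, hw⟩ := hw
    have h0 := isVal_diag_symSum n hw
    rw [h] at h0
    have h0' := h0.unique (by simpa using isVal_algebraMap (fun _ => u 0) 0)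
    rw [mul_eq_zero, map_eq_zero] at h0'
    rw [hw.msub_eq]
    rcases h0' with h0' | h0' <;> simp [h0']
  · rw [msub_of_not hw, mul_zero]

lemma renameHom_usum {r : ℕ → ℕ} (hr : Function.Injective r) (i j : ℕ) :
    renameHom r hr (usum i j) = ∑ k ∈ Finset.Icc i j, u (r k) := by
  simp [usum]

lemma sum_u_comp_eq_usum {r : ℕ → ℕ} (hr : Function.Injective r) {i j : ℕ}
    (h : ∀ k ∈ Finset.Icc i j, r k ∈ Finset.Icc i j) :
    ∑ k ∈ Finset.Icc i j, u (r k) = usum i j := by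
  rw [← Finset.sum_image fun x _ y _ e => hr e, usum]
  congr 1
  exact Finset.eq_of_subset_of_card_le (Finset.image_subset_iff.mpr h)
    (Finset.card_image_of_injective _ hr).ge

lemma prod_u_comp_eq {r : ℕ → ℕ} (hr : Function.Injective r) {i j : ℕ}
    (h : ∀ k ∈ Finset.Icc i j, r k ∈ Finset.Icc i j) :
    ∏ k ∈ Finset.Icc i j, u (r k) = ∏ k ∈ Finset.Icc i j, u k := by
  rw [← Finset.prod_image fun x _ y _ e => hr e]
  congr 1
  exact Finset.eq_of_subset_of_card_le (Finset.image_subset_iff.mpr h)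
    (Finset.card_image_of_injective _ hr).ge

/-- The cyclic permutation `i ↦ i + 1 ↦ ⋯ ↦ j ↦ i`. -/
def cyc (i j k : ℕ) : ℕ := if i ≤ k ∧ k < j then k + 1 else if k = j then i else k

lemma cyc_injective {i j : ℕ} (h : i ≤ j) : Function.Injective (cyc i j) := by
  intro a b e
  unfold cyc at e
  split_ifs at e <;> omega

lemma cyc_mem {i j k : ℕ} (hk : k ∈ Finset.Icc i j) : cyc i j k ∈ Finset.Icc i j := by
  rw [Finset.mem_Icc] at *
  unfold cyc
  split_ifs <;> omega

lemma cyc_of_lt {i j k : ℕ} (h1 : i ≤ k) (h2 : k < j) : cyc i j k = k + 1 := by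
  simp [cyc, h1, h2]

lemma cyc_of_not_mem {i j k : ℕ} (hij : i ≤ j) (h : k < i ∨ j < k) : cyc i j k = k := by
  unfold cyc
  split_ifs <;> omega

lemma symSum_cyc {N i j : ℕ} (hi : 1 ≤ i) (hij : i ≤ j) (hj : j ≤ N) (f : K) :
    symSum N (renameHom (cyc i j) (cyc_injective hij) f) = symSum N f := by
  obtain ⟨τ, hτ⟩ := exists_permExt_eq N (cyc i j) (cyc_injective hij)
    (fun k h1 h2 => by unfold cyc; split_ifs <;> omega)
    (fun k h => cyc_of_not_mem hij (by omega))
  rw [← symSum_permHom N τ f]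
  exact congrArg _ (hom_ext (by simp [hτ]) f)

lemma renameHom_cyc_usum {i j : ℕ} (hij : i ≤ j) :
    renameHom (cyc i j) (cyc_injective hij) (usum i j) = usum i j := by
  rw [renameHom_usum, sum_u_comp_eq_usum (cyc_injective hij) fun _ => cyc_mem]

lemma renameHom_add_usum (a i j : ℕ) (h : Function.Injective (· + a)) :
    renameHom (· + a) h (usum i j) = usum (i + a) (j + a) := by
  rw [renameHom_usum, usum, ← Finset.map_add_right_Icc, Finset.sum_map]
  rfl

lemma symSum_comp_underY {m n i : ℕ} (hi : 1 ≤ i) (him : i ≤ m) (f : K) {g : K}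
    (hg : g ∈ Mould n) :
    symSum (m + n) (comp (n + 1) i f (underY n g)) =
      symSum (m + n) (comp (n + 1) i f (overY n g)) := by
  have hij : i ≤ i + n := by omega
  rw [← symSum_cyc hi hij (by omega : i + n ≤ m + n) (comp (n + 1) i f (overY n g))]
  congr 1
  have hG : compSubG i = fun k => u (k + (i - 1)) := by
    funext k
    rw [compSubG, Nat.add_sub_assoc hi]
  simp only [comp, overY, underY, hG, msub_rename (add_left_injective (i - 1)),
    msub_rename (add_left_injective 1), map_mul, map_div₀, renameHom_add_usum, map_msub]
  have e1 : i + (n + 1) - 1 = i + n := by omega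
  have e2 : 1 + (i - 1) = i := by omega
  have e3 : n + 1 + (i - 1) = i + n := by omega
  rw [e1, e2, e3, renameHom_cyc_usum hij]
  congr 2
  · congr 1
    funext k
    unfold compSubF
    split_ifs with h1 h2
    · rw [renameHom_u, cyc_of_not_mem hij (Or.inl h1)]
    · rw [e1, renameHom_cyc_usum hij]
    · rw [renameHom_u, cyc_of_not_mem hij (Or.inr (by omega))]
  · rw [← RingHom.comp_apply, ← RingHom.comp_apply]
    refine hom_eqOn_mould (fun k h1 h2 => ?_) hg
    simp only [RingHom.comp_apply, renameHom_u]
    rw [cyc_of_lt (by omega) (by omega)]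
    congr 1
    omega

lemma symSum_ARIT (m n : ℕ) (f : K) {g : K} (hg : g ∈ Mould n) :
    symSum (m + n) (ARIT m n f g) = 0 := by
  rw [ARIT, symSum_sub, preLieComp, preLieComp, symSum_sum, symSum_sum, sub_eq_zero]
  refine Finset.sum_congr rfl fun i hi => ?_
  rw [Finset.mem_Icc] at hi
  exact (symSum_comp_underY hi.1 hi.2 f hg).symm

lemma symSum_LIMU {m n : ℕ} {f g : K} (hf : f ∈ Mould m) (hg : g ∈ Mould n) :
    symSum (m + n) (LIMU m n f g) = 0 := by
  let r : ℕ → ℕ := fun k =>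
    if 1 ≤ k ∧ k ≤ m then k + n else if m < k ∧ k ≤ m + n then k - m else k
  obtain ⟨τ, hτ⟩ := exists_permExt_eq (m + n) r
    (by intro a b h; simp only [r] at h; split_ifs at h <;> omega)
    (by intro k h1 h2; simp only [r]; split_ifs <;> omega)
    (by intro k h; simp only [r]; split_ifs <;> omega)
  rw [LIMU, symSum_sub, ← symSum_permHom (m + n) τ (MU m f g), sub_eq_zero]
  congr 1
  rw [MU, MU, map_mul, show shiftSub m = fun k => u (k + m) from rfl,
    show shiftSub n = fun k => u (k + n) from rfl, msub_rename (add_left_injective m),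
    msub_rename (add_left_injective n)]
  rw [mul_comm]
  congr 1
  · rw [← RingHom.comp_apply]
    refine hom_eqOn_mould (ψ := RingHom.id K) (fun k h1 h2 => ?_) hg
    have : r (k + m) = k := by simp only [r]; split_ifs <;> omega
    simp [hτ, this]
  · refine hom_eqOn_mould (fun k h1 h2 => ?_) hf
    simp [hτ, r, h1, h2]

lemma isVal_diag_renameHom_iff {r l : ℕ → ℕ} (hr : Function.Injective r)
    (hl : Function.LeftInverse l r) (f w : K) :
    IsVal (fun _ => u 0) (renameHom r hr f) w ↔ IsVal (fun _ => u 0) f w := by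
  have hd (s : ℕ → ℕ) (p : MPoly) : pev (fun _ => u 0) (rename s p) = pev (fun _ => u 0) p := by
    rw [pev_comp_algHom]
    simp
  have hmap (p : MPoly) : renameHom r hr (algebraMap MPoly K p) =
      algebraMap MPoly K (rename r p) := by
    rw [← pev_u, map_pev, ← pev_u, pev_comp_algHom]
    simp
  constructor
  · rintro ⟨p, q, hq, h, hv, rfl⟩
    have hlq : rename l q ≠ 0 := fun h0 => hv (by rw [← hd l, h0, map_zero])
    refine ⟨rename l p, rename l q, hlq, ?_, by rwa [hd], by rw [hd, hd]⟩
    obtain ⟨a, b, hb, rfl⟩ := IsFractionRing.div_surjective (A := MPoly) f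
    have hb := nonZeroDivisors.ne_zero hb
    have hrb : rename r b ≠ 0 := fun h0 => hb (rename_injective r hr (by rw [h0, map_zero]))
    have ne {p : MPoly} (hp : p ≠ 0) := (FaithfulSMul.algebraMap_eq_zero_iff MPoly K).not.mpr hp
    rw [map_div₀, hmap, hmap, div_eq_div_iff (ne hrb) (ne hq), ← map_mul, ← map_mul] at h
    have h' := congrArg (rename l) (algebraMap_injective h)
    simp only [map_mul, rename_rename, hl.comp_eq_id, rename_id, AlgHom.id_apply] at h'
    rw [div_eq_div_iff (ne hb) (ne hlq), ← map_mul, ← map_mul, h']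
  · rintro ⟨p, q, hq, rfl, hv, rfl⟩
    refine ⟨rename r p, rename r q, fun h0 => hv (by rw [← hd r, h0, map_zero]), ?_,
      by rwa [hd], by rw [hd, hd]⟩
    rw [map_div₀, hmap, hmap]

lemma msub_congr_isVal {v : ℕ → K} {f g : K} (h : ∀ w, IsVal v f w ↔ IsVal v g w) :
    msub v f = msub v g := by
  by_cases hw : ∃ w, IsVal v g w
  · obtain ⟨w, hw⟩ := hw
    rw [hw.msub_eq, ((h w).mpr hw).msub_eq]
  · rw [msub_of_not hw, msub_of_not (by simpa only [h] using hw)]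

lemma msub_diag_renameHom_succ (f : K) :
    msub (fun _ => u 0) (renameHom (· + 1) (add_left_injective 1) f) = msub (fun _ => u 0) f :=
  msub_congr_isVal (isVal_diag_renameHom_iff _ (l := (· - 1)) (fun k => Nat.add_sub_cancel k 1) f)

lemma msub_div {v : ℕ → K} {s z : K} (hs : IsVal v s z) (hz : z ≠ 0) (f : K) :
    msub v (f / s) = msub v f / z := by
  have hs0 : s ≠ 0 := by
    rintro rfl
    exact hz (hs.unique (by simpa using isVal_algebraMap v 0))
  by_cases hw : ∃ w, IsVal v f w
  · obtain ⟨w, hw⟩ := hw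
    rw [hw.msub_eq, div_eq_mul_inv, div_eq_mul_inv, (hw.mul (hs.inv hz)).msub_eq]
  · rw [msub_of_not hw, zero_div, msub_of_not]
    rintro ⟨w, h⟩
    refine hw ⟨w * z, ?_⟩
    have := h.mul hs
    rwa [div_mul_cancel₀ _ hs0] at this

lemma isVal_diag_usum (m : ℕ) : IsVal (fun _ => u 0) (usum 1 m) (m * u 0) := by
  have : (m * u 0 : K) = ∑ _k ∈ Finset.Icc 1 m, u 0 := by simp
  rw [this]
  exact IsVal.sum _ fun k _ => isVal_u _ k

lemma map_msub_diag (φ : K →+* K) (h : φ (u 0) = u 0) (f : K) :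
    φ (msub (fun _ => u 0) f) = msub (fun _ => u 0) f := by
  rw [map_msub, h]

lemma symSum_div_usum (n : ℕ) (f : K) :
    symSum n (f / usum 1 n) = symSum n f / (u 0 * usum 1 n) := by
  rw [symSum, symSum, Finset.sum_div]
  refine Finset.sum_congr rfl fun σ _ => ?_
  rw [map_div₀, map_div₀]
  congr 1
  rw [permHom, renameHom_usum, sum_u_comp_eq_usum, usum, map_sum, Finset.mul_sum]
  · simp
  · exact permExt_injective n σ
  · exact fun k hk => permExt_mem n σ hk

lemma usum_ne_zero {m : ℕ} (hm : 1 ≤ m) : usum 1 m ≠ 0 := by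
  intro h
  have h1 := isVal_diag_usum m
  rw [h] at h1
  have h2 := h1.unique (by simpa using isVal_algebraMap (fun _ => u 0) 0)
  have : (m : K) ≠ 0 := by exact_mod_cast (by omega : m ≠ 0)
  exact mul_ne_zero this (u_ne_zero 0) h2

/-- Shift of the variables `u 1, u 2, …` that fixes the auxiliary variable `u 0`. -/
def succFix (k : ℕ) : ℕ := if k = 0 then 0 else k + 1

lemma succFix_injective : Function.Injective succFix := by
  intro a b h
  unfold succFix at h
  split_ifs at h <;> omega

lemma permExt_zero (n : ℕ) (σ : Equiv.Perm (Fin n)) : permExt n σ 0 = 0 := by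
  simp [permExt]

lemma permExt_decomposeFin {m k : ℕ} (p : Fin (m + 1)) (τ : Equiv.Perm (Fin m))
    (h1 : 1 ≤ k) (h2 : k ≤ m) :
    permExt (m + 1) (Equiv.Perm.decomposeFin.symm (p, τ)) (k + 1) =
      permExt (m + 1) (Equiv.swap 0 p) (succFix (permExt m τ k)) := by
  have e : (⟨k + 1 - 1, by omega⟩ : Fin (m + 1)) = Fin.succ ⟨k - 1, by omega⟩ :=
    Fin.ext (by simp; omega)
  have hlt := (τ ⟨k - 1, by omega⟩).isLt
  have e' : (⟨(τ ⟨k - 1, by omega⟩ : ℕ) + 1, by omega⟩ : Fin (m + 1)) =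
    Fin.succ (τ ⟨k - 1, by omega⟩) := rfl
  have h3 : 1 ≤ k + 1 ∧ k + 1 ≤ m + 1 := by omega
  simp only [permExt, h1, h2, h3, and_self, dite_true, e,
    Equiv.Perm.decomposeFin_symm_apply_succ, succFix, Nat.succ_ne_zero, if_false]
  rw [dif_pos (by omega)]
  simp only [Nat.add_sub_cancel, e']

lemma symSum_renameHom_succ {m : ℕ} {f : K} (hf : f ∈ Mould m) (hfv : IsVegetal m f) :
    (∏ k ∈ Finset.Icc 1 (m + 1), u k) *
        symSum (m + 1) (renameHom (· + 1) (add_left_injective 1) f) =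
      m.factorial * msub (fun _ => u 0) f * usum 1 (m + 1) := by
  rw [IsVegetal, sum_msub_eq_symSum] at hfv
  let φ (p : Fin (m + 1)) : K →+* K :=
    (permHom (m + 1) (Equiv.swap 0 p)).comp (renameHom succFix succFix_injective)
  have hsum : symSum (m + 1) (renameHom (· + 1) (add_left_injective 1) f) =
      ∑ p, φ p (symSum m f) := by
    simp only [symSum, map_sum]
    rw [← Equiv.Perm.decomposeFin.symm.sum_comp, Fintype.sum_prod_type]
    refine Finset.sum_congr rfl fun p _ => Finset.sum_congr rfl fun τ _ => ?_
    simp only [← RingHom.comp_apply]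
    refine hom_eqOn_mould (fun k h1 h2 => ?_) hf
    simp [φ, permExt_decomposeFin p τ h1 h2, permExt_zero, succFix]
  have hprod (p : Fin (m + 1)) :
      ∏ k ∈ Finset.Icc 1 (m + 1), u k = u (p + 1) * φ p (∏ k ∈ Finset.Icc 1 m, u k) := by
    have h : ∏ k ∈ Finset.Icc 1 (m + 1), u k =
        u 1 * renameHom succFix succFix_injective (∏ k ∈ Finset.Icc 1 m, u k) := by
      rw [map_prod, ← Finset.mul_prod_Ioc_eq_prod_Icc (by omega : 1 ≤ m + 1)]
      congr 1
      have : Finset.Ioc 1 (m + 1) = (Finset.Icc 1 m).map (addRightEmbedding 1) := by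
        rw [Finset.map_add_right_Icc]
        rfl
      rw [this, Finset.prod_map]
      refine Finset.prod_congr rfl fun k hk => ?_
      have : k ≠ 0 := by have := Finset.mem_Icc.mp hk; omega
      simp [succFix, this]
    rw [← prod_u_comp_eq (permExt_injective (m + 1) (Equiv.swap 0 p)) fun _ => permExt_mem _ _]
    have h' := congrArg (permHom (m + 1) (Equiv.swap 0 p)) h
    rw [map_prod, map_mul] at h'
    simp only [permHom_u] at h'
    rw [h']
    simp [φ, permExt]
  have hterm (p : Fin (m + 1)) :
      (∏ k ∈ Finset.Icc 1 (m + 1), u k) * φ p (symSum m f) =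
        m.factorial * msub (fun _ => u 0) f * u (p + 1) := by
    have h := congrArg (φ p) hfv
    rw [map_mul, map_mul, map_natCast,
      map_msub_diag (φ p) (by simp [φ, succFix, permExt_zero])] at h
    rw [hprod p, mul_assoc, h]
    ring
  rw [hsum, Finset.mul_sum, Finset.sum_congr rfl fun p _ => hterm p, ← Finset.mul_sum]
  congr 1
  rw [Fin.sum_univ_eq_sum_range fun k => u (k + 1), usum, Finset.range_eq_Ico,
    Finset.sum_Ico_add' u 0 (m + 1) 1]
  rfl

lemma msub_diag_div_usum (m : ℕ) (f : K) :
    msub (fun _ => u 0) (f / usum 1 (m + 1)) = msub (fun _ => u 0) f / ((m + 1) * u 0) := by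
  have h : ((m : K) + 1) ≠ 0 := by exact_mod_cast m.succ_ne_zero
  exact msub_div (by simpa using isVal_diag_usum (m + 1)) (mul_ne_zero h (u_ne_zero 0)) f

lemma isVegetal_underY {m : ℕ} {f : K} (hf : f ∈ Mould m) (hfv : IsVegetal m f) :
    IsVegetal (m + 1) (underY m f) := by
  have h1 : ((m : K) + 1) ≠ 0 := by exact_mod_cast m.succ_ne_zero
  have h2 := u_ne_zero 0
  have h3 := usum_ne_zero (Nat.le_add_left 1 m)
  rw [IsVegetal, sum_msub_eq_symSum, underY, msub_rename (add_left_injective 1),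
    symSum_div_usum, ← mul_div_assoc, symSum_renameHom_succ hf hfv, msub_diag_div_usum,
    msub_diag_renameHom_succ, Nat.factorial_succ]
  push_cast
  field_simp

lemma symSum_overY {m : ℕ} {f : K} (hf : f ∈ Mould m) :
    symSum (m + 1) (overY m f) = symSum (m + 1) (underY m f) := by
  have hij : 1 ≤ m + 1 := by omega
  rw [← symSum_cyc le_rfl hij le_rfl (overY m f), overY, underY,
    msub_rename (add_left_injective 1), map_div₀, renameHom_cyc_usum hij]
  congr 2
  refine hom_eqOn_mould (fun k h1 h2 => ?_) hf
  rw [renameHom_u, renameHom_u, cyc_of_lt h1 (by omega)]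

lemma isVegetal_overY {m : ℕ} {f : K} (hf : f ∈ Mould m) (hfv : IsVegetal m f) :
    IsVegetal (m + 1) (overY m f) := by
  have h := isVegetal_underY hf hfv
  rw [IsVegetal, sum_msub_eq_symSum] at h ⊢
  rw [symSum_overY hf, h, overY, underY, msub_rename (add_left_injective 1),
    msub_diag_div_usum, msub_diag_div_usum, msub_diag_renameHom_succ]

/-- if `f ∈ Mould m` and `g ∈ Mould n` are vegetal, then `f/Y`
and `Y\f` are vegetal, and `ARIT(f,g)` and `ARI(f,g)` are vegetal elements of
`Mould (m+n)`. -/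
theorem vegetal_ARIT_ARI (m n : ℕ) (hm : 1 ≤ m) (hn : 1 ≤ n)
    (f g : K) (hf : f ∈ Mould m) (hg : g ∈ Mould n)
    (hfv : IsVegetal m f) (hgv : IsVegetal n g) :
    IsVegetal (m + 1) (overY m f) ∧
    IsVegetal (m + 1) (underY m f) ∧
    IsVegetal (m + n) (ARIT m n f g) ∧
    IsVegetal (m + n) (ARI m n f g) := by
  refine ⟨isVegetal_overY hf hfv, isVegetal_underY hf hfv,
    isVegetal_of_symSum_eq_zero _ (symSum_ARIT m n f hg), isVegetal_of_symSum_eq_zero _ ?_⟩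
  rw [ARI, symSum_add, symSum_sub, symSum_ARIT m n f hg, symSum_LIMU hf hg, add_comm m n,
    symSum_ARIT n m g hf, sub_zero, add_zero]

end MouldOperad
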